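/- arXiv:1406.6454 — 3 statements merged into one kernel-verified Lean document; each statement's English description precedes it below -/
import Mathlib

section
/- For every integer m ≥ 1, the normalized Laplacian of the petal graph on 2m+1 vertices (m triangles all sharing one common vertex) has eigenvalue 0 with multiplicity 1, eigenvalue 1/2 with multiplicity m−1, and eigenvalue 3/2 with multiplicity m+1. -/
/- The petal (friendship) graph on `2m+1` vertices: `m` triangles all joined at one
common vertex. The vertex `none` is the common center, and for each `i : Fin m` the two
vertices `some (i, 0)` and `some (i, 1)` form the `i`-th triangle with the center. -/
def petalGraph (m : ℕ) : SimpleGraph (Option (Fin m × Fin 2)) :=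
  SimpleGraph.fromRel fun x y =>
    (x = none ∧ y ≠ none) ∨ ∃ i : Fin m, x = some (i, 0) ∧ y = some (i, 1)

/- The normalized Laplacian `Δ_G = I - D⁻¹ A` of a finite simple graph. -/
open scoped Classical in
noncomputable def normLap {V : Type*} [Fintype V] (G : SimpleGraph V) : Matrix V V ℝ :=
  Matrix.of fun i j =>
    (if i = j then (1 : ℝ) else 0) -
      (if G.Adj i j then 1 / ((Finset.univ.filter fun k => G.Adj i k).card : ℝ) else 0)

open Kronecker in
/-- The determinant of a matrix with `m` equal diagonal blocks `[y, c; c, y]` bordered by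
constant vectors, multiplied by the eigenvalue `y + c` of the block. -/
lemma det_fromBlocks_kronecker_border {R : Type*} [CommRing R] (m : ℕ) (y b c r : R) :
    (Matrix.fromBlocks ((1 : Matrix (Fin m) (Fin m) R) ⊗ₖ !![y, c; c, y])
        (Matrix.of fun _ (_ : PUnit.{1}) => b) (Matrix.of fun (_ : PUnit.{1}) _ => r)
        (Matrix.of fun (_ _ : PUnit.{1}) => y)).det * (y + c)
      = (y ^ 2 - c ^ 2) ^ m * (y * (y + c) - 2 * m * r * b) := by
  have key : (Matrix.fromBlocks ((1 : Matrix (Fin m) (Fin m) R) ⊗ₖ !![y, c; c, y])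
        (Matrix.of fun _ (_ : PUnit.{1}) => b) (Matrix.of fun (_ : PUnit.{1}) _ => r)
        (Matrix.of fun (_ _ : PUnit.{1}) => y)) *
      Matrix.fromBlocks 1 (Matrix.of fun _ (_ : PUnit.{1}) => -b) 0
        (Matrix.of fun (_ _ : PUnit.{1}) => y + c) =
      Matrix.fromBlocks ((1 : Matrix (Fin m) (Fin m) R) ⊗ₖ !![y, c; c, y]) 0
        (Matrix.of fun (_ : PUnit.{1}) _ => r)
        (Matrix.of fun (_ _ : PUnit.{1}) => y * (y + c) - 2 * m * r * b) := by
    rw [Matrix.fromBlocks_multiply]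
    congr 1
    · simp
    · ext ⟨i, a⟩ j
      simp only [Matrix.add_apply, Matrix.mul_apply, Fintype.sum_prod_type, Matrix.one_apply,
        Matrix.kroneckerMap_apply, Matrix.of_apply, Matrix.zero_apply]
      fin_cases a <;> simp <;> ring
    · simp
    · ext i j
      simp [Matrix.mul_apply]
      ring
  have h := congrArg Matrix.det key
  rw [Matrix.det_mul, Matrix.det_fromBlocks_zero₂₁, Matrix.det_fromBlocks_zero₁₂,
    Matrix.det_kronecker] at h
  simpa [Matrix.det_fin_two, sq] using h

lemma petalGraph_adj_none_some (m : ℕ) (p : Fin m × Fin 2) :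
    (petalGraph m).Adj none (some p) := by
  simp [petalGraph]

lemma petalGraph_adj_some_some (m : ℕ) (p q : Fin m × Fin 2) :
    (petalGraph m).Adj (some p) (some q) ↔ p.1 = q.1 ∧ p.2 ≠ q.2 := by
  obtain ⟨i, a⟩ := p
  obtain ⟨j, b⟩ := q
  fin_cases a <;> fin_cases b <;> simp [petalGraph, eq_comm]

open scoped Classical in
lemma petalGraph_card_adj_none (m : ℕ) :
    (Finset.univ.filter fun k => (petalGraph m).Adj none k).card = 2 * m := by
  rw [Finset.card_filter, Fintype.sum_option]
  simp [petalGraph_adj_none_some, mul_comm]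

open scoped Classical in
lemma petalGraph_card_adj_some (m : ℕ) (p : Fin m × Fin 2) :
    (Finset.univ.filter fun k => (petalGraph m).Adj (some p) k).card = 2 := by
  obtain ⟨i, a⟩ := p
  rw [Finset.card_filter, Fintype.sum_option, Fintype.sum_prod_type]
  simp only [(petalGraph_adj_none_some m _).symm, petalGraph_adj_some_some, if_true,
    Fin.sum_univ_two]
  fin_cases a <;> simp

open Polynomial Kronecker in
lemma normLap_petalGraph_charmatrix (m : ℕ) :
    (normLap (petalGraph m)).charmatrix.reindex (Equiv.optionEquivSumPUnit.{0} _)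
        (Equiv.optionEquivSumPUnit.{0} _) =
      Matrix.fromBlocks
        ((1 : Matrix (Fin m) (Fin m) ℝ[X]) ⊗ₖ !![X - 1, C (1 / 2); C (1 / 2), X - 1])
        (Matrix.of fun _ (_ : PUnit.{1}) => C (1 / 2))
        (Matrix.of fun (_ : PUnit.{1}) _ => C (1 / (2 * (m : ℝ))))
        (Matrix.of fun (_ _ : PUnit.{1}) => X - 1) := by
  ext1 x y
  rcases x with ⟨i, a⟩ | x <;> rcases y with ⟨j, b⟩ | y
  · have h := petalGraph_card_adj_some m (i, a)
    by_cases hij : i = j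
    · subst hij
      fin_cases a <;> fin_cases b <;>
        simp_all [normLap, petalGraph_adj_some_some]
    · simp_all [normLap, petalGraph_adj_some_some]
  · simp [normLap, petalGraph_card_adj_some,
      (petalGraph_adj_none_some m _).symm]
  · simp [normLap, petalGraph_card_adj_none, petalGraph_adj_none_some]
  · simp [normLap]

open Polynomial in
lemma normLap_petalGraph_charpoly (m : ℕ) (hm : 1 ≤ m) :
    (normLap (petalGraph m)).charpoly =
      X * (X - C (1 / 2)) ^ (m - 1) * (X - C (3 / 2)) ^ (m + 1) := by
  have h := det_fromBlocks_kronecker_border m (X - 1 : ℝ[X]) (C (1 / 2)) (C (1 / 2))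
    (C (1 / (2 * (m : ℝ))))
  rw [← normLap_petalGraph_charmatrix, Matrix.det_reindex_self] at h
  have h2 : (2 * C (1 / 2) : ℝ[X]) = 1 := by
    rw [← C_ofNat, ← C_mul, ← C_1]; norm_num
  have hy : (X - 1 + C (1 / 2) : ℝ[X]) = X - C (1 / 2) := by
    linear_combination h2
  have hr : 2 * (m : ℝ[X]) * C (1 / (2 * (m : ℝ))) = 1 := by
    have : (m : ℝ) ≠ 0 := by positivity
    rw [← C_ofNat, ← C_eq_natCast, ← C_mul, ← C_mul, ← C_1]
    congr 1
    field_simp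
  have hne : (X - C (1 / 2) : ℝ[X]) ≠ 0 := X_sub_C_ne_zero _
  apply mul_right_cancel₀ hne
  obtain ⟨k, rfl⟩ := Nat.exists_eq_add_of_le' hm
  rw [hr, hy] at h
  rw [Matrix.charpoly, h]
  have h3 : (C (3 / 2) : ℝ[X]) = 1 + C (1 / 2) := by
    rw [← C_1, ← C_add]; norm_num
  have e1 : ((X - 1) ^ 2 - C (1 / 2) ^ 2 : ℝ[X]) = (X - C (1 / 2)) * (X - C (3 / 2)) := by
    rw [h3]
    linear_combination (X - 1 - C (1 / 2)) * h2
  have e2 : ((X - 1) * (X - C (1 / 2)) - 1 * C (1 / 2) : ℝ[X]) = X * (X - C (3 / 2)) := by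
    rw [h3]
    ring
  rw [e1, e2, mul_pow, Nat.add_sub_cancel]
  ring

/-- For every `m ≥ 1`, the normalized Laplacian of the petal graph on `2m+1` vertices has
eigenvalue `0` with multiplicity `1`, eigenvalue `1/2` with multiplicity `m-1`, and
eigenvalue `3/2` with multiplicity `m+1`. -/
theorem normLap_petalGraph_spectrum (m : ℕ) (hm : 1 ≤ m) :
    (normLap (petalGraph m)).charpoly.roots
      = Multiset.replicate 1 (0 : ℝ)
        + Multiset.replicate (m - 1) ((1 : ℝ) / 2)
        + Multiset.replicate (m + 1) ((3 : ℝ) / 2) := by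
  have hC (a : ℝ) : (Polynomial.X - Polynomial.C a) ≠ 0 := Polynomial.X_sub_C_ne_zero a
  rw [normLap_petalGraph_charpoly m hm,
    Polynomial.roots_mul (mul_ne_zero (mul_ne_zero Polynomial.X_ne_zero (pow_ne_zero _ (hC _)))
      (pow_ne_zero _ (hC _))),
    Polynomial.roots_mul (mul_ne_zero Polynomial.X_ne_zero (pow_ne_zero _ (hC _))),
    Polynomial.roots_pow, Polynomial.roots_pow, Polynomial.roots_X, Polynomial.roots_X_sub_C,
    Polynomial.roots_X_sub_C, Multiset.nsmul_singleton, Multiset.nsmul_singleton,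
    Multiset.replicate_one]
end

section
/- Fix σ > 0. Let μ_n, ν_n (n ∈ ℕ) and μ_0 be probability measures on [0,2], and for a probability measure μ on [0,2] define its Gaussian-smoothed density ρ_μ(x) = ∫ (1/√(2πσ²)) exp(−(x − λ)²/(2σ²)) dμ(λ) for x ∈ ℝ. If both μ_n and ν_n converge weakly to μ_0 as n → ∞, then ∫_ℝ |ρ_{μ_n}(x) − ρ_{ν_n}(x)| dx → 0. -/
open MeasureTheory Filter

/-- If a continuous kernel `K` is dominated on `s` by an integrable function of its first variable,
then two sequences of probability measures carried by `s` whose averages of each `K x` share a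
limit have averaged kernels that are asymptotically equal in `L¹`. -/
theorem tendsto_integral_abs_sub_of_kernel_le {K : ℝ → ℝ → ℝ} {g : ℝ → ℝ} {s : Set ℝ}
    (hK : Continuous (Function.uncurry K)) (hg : Integrable g)
    (hKg : ∀ x, ∀ l ∈ s, ‖K x l‖ ≤ g x) {μ ν : ℕ → Measure ℝ} {L : ℝ → ℝ}
    [∀ n, IsProbabilityMeasure (μ n)] [∀ n, IsProbabilityMeasure (ν n)]
    (hμs : ∀ n, ∀ᵐ l ∂ μ n, l ∈ s) (hνs : ∀ n, ∀ᵐ l ∂ ν n, l ∈ s)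
    (hμ : ∀ x, Tendsto (fun n => ∫ l, K x l ∂ μ n) atTop (nhds (L x)))
    (hν : ∀ x, Tendsto (fun n => ∫ l, K x l ∂ ν n) atTop (nhds (L x))) :
    Tendsto (fun n => ∫ x, |(∫ l, K x l ∂ μ n) - ∫ l, K x l ∂ ν n|) atTop (nhds 0) := by
  have meas (m : Measure ℝ) [IsProbabilityMeasure m] :
      StronglyMeasurable fun x => ∫ l, K x l ∂ m :=
    hK.stronglyMeasurable.integral_prod_right
  have bound (m : Measure ℝ) [IsProbabilityMeasure m] (hm : ∀ᵐ l ∂ m, l ∈ s) (x : ℝ) :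
      |∫ l, K x l ∂ m| ≤ g x := by
    simpa using norm_integral_le_of_norm_le_const (hm.mono (hKg x))
  have key := tendsto_integral_of_dominated_convergence (μ := volume)
    (F := fun n x => |(∫ l, K x l ∂ μ n) - ∫ l, K x l ∂ ν n|) (f := fun _ => 0)
    (fun x => g x + g x)
    (fun n => ((meas (μ n)).sub (meas (ν n))).norm.aestronglyMeasurable)
    (hg.add hg)
    (fun n => .of_forall fun x => by
      rw [Real.norm_eq_abs, abs_abs]
      exact (abs_sub _ _).trans (add_le_add (bound _ (hμs n) x) (bound _ (hνs n) x)))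
    (.of_forall fun x => by simpa using ((hμ x).sub (hν x)).abs)
  simpa using key

theorem exp_neg_sub_sq_div_le {c x l : ℝ} (hc : 0 < c) (hl : l ∈ Set.Icc (0 : ℝ) 2) :
    Real.exp (-(x - l) ^ 2 / c) ≤ Real.exp (4 / c) * Real.exp (-(1 / (2 * c)) * x ^ 2) := by
  rw [← Real.exp_add, Real.exp_le_exp]
  have h : 4 / c + -(1 / (2 * c)) * x ^ 2 = (4 - x ^ 2 / 2) / c := by
    field_simp
    ring
  rw [h]
  gcongr
  nlinarith [sq_nonneg (x - 2 * l), hl.1, hl.2]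

/-- Fix `σ > 0`. Let `μ_n`, `ν_n` and `μ_0` be probability measures on `[0,2]`, and for a
probability measure `μ` on `[0,2]` let `ρ_μ(x) = ∫ (1/√(2πσ²)) exp(-(x-λ)²/(2σ²)) dμ(λ)`
be its Gaussian-smoothed density. If both `μ_n` and `ν_n` converge weakly to `μ_0`
(i.e. `∫ f dμ_n → ∫ f dμ_0` for every continuous `f : [0,2] → ℝ`, and likewise for
`ν_n`), then `∫_ℝ |ρ_{μ_n}(x) - ρ_{ν_n}(x)| dx → 0`. -/
theorem spectral_distance_tendsto_zero_of_same_weak_limit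
    (σ : ℝ) (hσ : 0 < σ)
    (μ ν : ℕ → Measure ℝ) (μ0 : Measure ℝ)
    (hμp : ∀ n, IsProbabilityMeasure (μ n)) (hνp : ∀ n, IsProbabilityMeasure (ν n))
    (hμ0p : IsProbabilityMeasure μ0)
    (hμs : ∀ n, μ n (Set.Icc (0 : ℝ) 2)ᶜ = 0) (hνs : ∀ n, ν n (Set.Icc (0 : ℝ) 2)ᶜ = 0)
    (hμ0s : μ0 (Set.Icc (0 : ℝ) 2)ᶜ = 0)
    (hμw : ∀ f : ℝ → ℝ, ContinuousOn f (Set.Icc 0 2) →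
      Tendsto (fun n => ∫ l, f l ∂ μ n) atTop (nhds (∫ l, f l ∂ μ0)))
    (hνw : ∀ f : ℝ → ℝ, ContinuousOn f (Set.Icc 0 2) →
      Tendsto (fun n => ∫ l, f l ∂ ν n) atTop (nhds (∫ l, f l ∂ μ0))) :
    Tendsto
      (fun n => ∫ x : ℝ,
        |(∫ l, (1 / Real.sqrt (2 * Real.pi * σ ^ 2)) *
            Real.exp (-(x - l) ^ 2 / (2 * σ ^ 2)) ∂ μ n)
          - (∫ l, (1 / Real.sqrt (2 * Real.pi * σ ^ 2)) *
              Real.exp (-(x - l) ^ 2 / (2 * σ ^ 2)) ∂ ν n)|)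
      atTop (nhds 0) := by
  refine tendsto_integral_abs_sub_of_kernel_le (s := Set.Icc 0 2)
    (K := fun x l => (1 / Real.sqrt (2 * Real.pi * σ ^ 2)) *
      Real.exp (-(x - l) ^ 2 / (2 * σ ^ 2)))
    (g := fun x => (1 / Real.sqrt (2 * Real.pi * σ ^ 2)) *
      (Real.exp (4 / (2 * σ ^ 2)) * Real.exp (-(1 / (2 * (2 * σ ^ 2))) * x ^ 2)))
    (by fun_prop) (((integrable_exp_neg_mul_sq (by positivity)).const_mul _).const_mul _)
    (fun x l hl => ?_) hμs hνs
    (fun x => hμw _ (by fun_prop)) (fun x => hνw _ (by fun_prop))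
  rw [Real.norm_of_nonneg (by positivity)]
  gcongr
  exact exp_neg_sub_sq_div_le (by positivity) hl
end

section
/- Fix σ > 0 and an integer C ≥ 1. There exists a constant M > 0 (depending only on σ and C) such that for all n ≥ 2, the spectral distance between the complete graphs K_n and K_{n+C} satisfies D(K_n, K_{n+C}) ≤ M/n². -/
/- The Gaussian-smoothed spectral density with bandwidth `σ`:
`ρ_G(x) = (1/n) ∑_i (1/√(2πσ²)) exp(-(x-λ_i)²/(2σ²))`, the sum running over the
eigenvalues of the normalized Laplacian counted with multiplicity. -/
noncomputable def specDensity (σ : ℝ) {V : Type*} [Fintype V] [DecidableEq V]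
    (G : SimpleGraph V) (x : ℝ) : ℝ :=
  ((Fintype.card V : ℝ))⁻¹ *
    (((normLap G).charpoly.roots).map
      (fun l => (1 / Real.sqrt (2 * Real.pi * σ ^ 2)) *
        Real.exp (-(x - l) ^ 2 / (2 * σ ^ 2)))).sum

/-- The normalized Laplacian of `K_n` is a scalar matrix plus a rank one matrix. -/
theorem normLap_top (n : ℕ) (hn : 2 ≤ n) :
    normLap (⊤ : SimpleGraph (Fin n)) =
      Matrix.vecMulVec (fun _ => -(1 / ((n : ℝ) - 1))) (fun _ => 1)
        - Matrix.scalar (Fin n) (-((n : ℝ) / ((n : ℝ) - 1))) := by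
  have hn' : (2 : ℝ) ≤ n := by exact_mod_cast hn
  have h1 : (n : ℝ) - 1 ≠ 0 := by linarith
  ext i j
  have hcard : ((Finset.univ.filter fun k : Fin n => i ≠ k).card : ℝ) = (n : ℝ) - 1 := by
    rw [Finset.filter_ne, Finset.card_erase_of_mem (Finset.mem_univ i), Finset.card_univ,
      Fintype.card_fin, Nat.cast_sub (by omega), Nat.cast_one]
  simp only [normLap, Matrix.of_apply, SimpleGraph.top_adj, hcard, Matrix.sub_apply,
    Matrix.vecMulVec_apply, Matrix.scalar_apply, Matrix.diagonal_apply]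
  by_cases h : i = j
  · simp only [h, ne_eq, not_true_eq_false, if_true, if_false]
    field_simp
    ring
  · simp [h]

open Polynomial in
theorem charpoly_normLap_top (n : ℕ) (hn : 2 ≤ n) :
    (normLap (⊤ : SimpleGraph (Fin n))).charpoly =
      (X - C ((n : ℝ) / ((n : ℝ) - 1))) ^ (n - 1) * (X - C 0) := by
  obtain ⟨k, rfl⟩ : ∃ k, n = k + 1 := ⟨n - 1, by omega⟩
  rw [normLap_top _ hn, Matrix.charpoly_sub_scalar, Matrix.charpoly_vecMulVec]
  simp only [dotProduct, mul_one, Finset.sum_const, Finset.card_univ, Fintype.card_fin,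
    nsmul_eq_mul, smul_eq_C_mul, sub_comp, mul_comp, pow_comp, X_comp, C_comp,
    Nat.add_sub_cancel, pow_succ]
  simp only [mul_neg, mul_one_div, C_neg, C_0]
  ring

/-- The smoothed spectral density of `K_n`. -/
theorem specDensity_top (σ : ℝ) (n : ℕ) (hn : 2 ≤ n) (x : ℝ) :
    specDensity σ (⊤ : SimpleGraph (Fin n)) x =
      (1 / Real.sqrt (2 * Real.pi * σ ^ 2)) *
        ((1 / (n : ℝ)) * Real.exp (-(x - 0) ^ 2 / (2 * σ ^ 2)) +
          (1 - 1 / (n : ℝ)) *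
            Real.exp (-(x - (n : ℝ) / ((n : ℝ) - 1)) ^ 2 / (2 * σ ^ 2))) := by
  have hn' : (2 : ℝ) ≤ n := by exact_mod_cast hn
  have hroots : (normLap (⊤ : SimpleGraph (Fin n))).charpoly.roots =
      (n - 1) • {(n : ℝ) / ((n : ℝ) - 1)} + {0} := by
    rw [charpoly_normLap_top n hn, Polynomial.roots_mul, Polynomial.roots_pow,
      Polynomial.roots_X_sub_C, Polynomial.roots_X_sub_C]
    exact mul_ne_zero (pow_ne_zero _ (Polynomial.X_sub_C_ne_zero _))
      (Polynomial.X_sub_C_ne_zero _)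
  rw [specDensity, hroots, Fintype.card_fin, Multiset.map_add, Multiset.map_nsmul,
    Multiset.sum_add, Multiset.sum_nsmul, Multiset.map_singleton, Multiset.map_singleton,
    Multiset.sum_singleton, Multiset.sum_singleton, nsmul_eq_mul, Nat.cast_sub (by omega),
    Nat.cast_one]
  generalize Real.exp (-(x - 0) ^ 2 / (2 * σ ^ 2)) = A
  generalize Real.exp (-(x - (n : ℝ) / ((n : ℝ) - 1)) ^ 2 / (2 * σ ^ 2)) = B
  generalize 1 / Real.sqrt (2 * Real.pi * σ ^ 2) = c
  have : (n : ℝ) ≠ 0 := by linarith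
  field_simp
  ring

/-- Gaussians with centre in `[0, 2]` depend on the centre in a Lipschitz way, uniformly with
respect to an integrable envelope. -/
theorem abs_gaussian_sub_gaussian_le {σ : ℝ} (hσ : 0 < σ) (x : ℝ) {a b : ℝ}
    (ha : a ∈ Set.Icc (0 : ℝ) 2) (hb : b ∈ Set.Icc (0 : ℝ) 2) :
    |Real.exp (-(x - b) ^ 2 / (2 * σ ^ 2)) - Real.exp (-(x - a) ^ 2 / (2 * σ ^ 2))| ≤
      (1 / σ * Real.exp (1 / σ ^ 2)) * Real.exp (-(1 / (8 * σ ^ 2)) * x ^ 2) * |b - a| := by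
  have hderiv : ∀ l ∈ Set.Icc (0 : ℝ) 2,
      HasDerivWithinAt (fun l => Real.exp (-(x - l) ^ 2 / (2 * σ ^ 2)))
        (Real.exp (-(x - l) ^ 2 / (2 * σ ^ 2)) * ((x - l) / σ ^ 2)) (Set.Icc 0 2) l := by
    intro l _
    have h := ((((hasDerivAt_id' l).const_sub x).pow 2).neg.div_const (2 * σ ^ 2)).exp
    refine (h.congr_deriv ?_).hasDerivWithinAt
    congr 1
    field_simp
    simp [mul_comm]
  have hbound : ∀ l ∈ Set.Icc (0 : ℝ) 2,
      ‖Real.exp (-(x - l) ^ 2 / (2 * σ ^ 2)) * ((x - l) / σ ^ 2)‖ ≤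
        (1 / σ * Real.exp (1 / σ ^ 2)) * Real.exp (-(1 / (8 * σ ^ 2)) * x ^ 2) := by
    rintro l ⟨hl0, hl2⟩
    have hu : |x - l| / σ ≤ Real.exp ((x - l) ^ 2 / (4 * σ ^ 2)) := by
      have h1 := Real.add_one_le_exp ((x - l) ^ 2 / (4 * σ ^ 2))
      have h2 : (x - l) ^ 2 / (4 * σ ^ 2) = (|x - l| / σ) ^ 2 / 4 := by
        rw [div_pow, sq_abs]
        field_simp
      nlinarith [sq_nonneg (|x - l| / σ - 2)]
    have hexp : -(x - l) ^ 2 / (2 * σ ^ 2) + (x - l) ^ 2 / (4 * σ ^ 2) ≤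
        1 / σ ^ 2 + -(1 / (8 * σ ^ 2)) * x ^ 2 := by
      have h3 : 1 / σ ^ 2 + -(1 / (8 * σ ^ 2)) * x ^ 2 -
          (-(x - l) ^ 2 / (2 * σ ^ 2) + (x - l) ^ 2 / (4 * σ ^ 2)) =
          (8 - x ^ 2 + 2 * (x - l) ^ 2) / (8 * σ ^ 2) := by
        field_simp
        ring
      have h4 : 0 ≤ (8 - x ^ 2 + 2 * (x - l) ^ 2) / (8 * σ ^ 2) := by
        apply div_nonneg _ (by positivity)
        nlinarith [sq_nonneg (x - 2 * l)]
      linarith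
    rw [Real.norm_eq_abs, abs_mul, abs_of_pos (Real.exp_pos _), abs_div,
      abs_of_pos (show 0 < σ ^ 2 by positivity)]
    calc Real.exp (-(x - l) ^ 2 / (2 * σ ^ 2)) * (|x - l| / σ ^ 2)
        = 1 / σ * (Real.exp (-(x - l) ^ 2 / (2 * σ ^ 2)) * (|x - l| / σ)) := by
          field_simp
      _ ≤ 1 / σ * (Real.exp (-(x - l) ^ 2 / (2 * σ ^ 2)) *
            Real.exp ((x - l) ^ 2 / (4 * σ ^ 2))) := by gcongr
      _ ≤ 1 / σ * Real.exp (1 / σ ^ 2 + -(1 / (8 * σ ^ 2)) * x ^ 2) := by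
          rw [← Real.exp_add]
          gcongr
      _ = _ := by rw [Real.exp_add, mul_assoc]
  have := (convex_Icc (0 : ℝ) 2).norm_image_sub_le_of_norm_hasDerivWithin_le hderiv hbound ha hb
  simpa only [Real.norm_eq_abs] using this

theorem div_sub_one_mem_Icc {t : ℝ} (ht : 2 ≤ t) : t / (t - 1) ∈ Set.Icc (0 : ℝ) 2 := by
  have h : 0 < t - 1 := by linarith
  refine ⟨by positivity, ?_⟩
  rw [div_le_iff₀ h]
  linarith

/-- Pointwise estimate behind the bound on the spectral distance. -/
theorem abs_specDensity_top_sub_le {σ : ℝ} (hσ : 0 < σ) (C n : ℕ) (hn : 2 ≤ n) (x : ℝ) :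
    |specDensity σ (⊤ : SimpleGraph (Fin n)) x
        - specDensity σ (⊤ : SimpleGraph (Fin (n + C))) x| ≤
      (1 / Real.sqrt (2 * Real.pi * σ ^ 2) * (1 / σ * Real.exp (1 / σ ^ 2)) *
        (6 * C / (n : ℝ) ^ 2)) * Real.exp (-(1 / (8 * σ ^ 2)) * x ^ 2) := by
  have hn' : (2 : ℝ) ≤ n := by exact_mod_cast hn
  have hC : (0 : ℝ) ≤ C := C.cast_nonneg
  have hm' : (2 : ℝ) ≤ (n : ℝ) + C := by linarith
  rw [specDensity_top σ n hn, specDensity_top σ (n + C) (by omega), ← mul_sub, abs_mul,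
    abs_of_nonneg (show 0 ≤ 1 / Real.sqrt (2 * Real.pi * σ ^ 2) by positivity), Nat.cast_add]
  set m : ℝ := (n : ℝ) + C with hm
  have hbn := div_sub_one_mem_Icc hn'
  have hbm := div_sub_one_mem_Icc hm'
  have h1 := abs_gaussian_sub_gaussian_le hσ x hbn ⟨le_rfl, zero_le_two⟩
  have h2 := abs_gaussian_sub_gaussian_le hσ x hbm hbn
  have hd : (n : ℝ) / (n - 1) - m / (m - 1) = C / ((n - 1) * (m - 1)) := by
    have : (n : ℝ) - 1 ≠ 0 := by linarith
    have : m - 1 ≠ 0 := by linarith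
    field_simp
    rw [hm]
    ring
  have hd' : |(n : ℝ) / (n - 1) - m / (m - 1)| ≤ 4 * C / (n : ℝ) ^ 2 := by
    have hpos : 0 < ((n : ℝ) - 1) * (m - 1) := mul_pos (by linarith) (by linarith)
    rw [hd, abs_of_nonneg (div_nonneg hC hpos.le), div_le_div_iff₀ hpos (by positivity)]
    have : (n : ℝ) ^ 2 ≤ 4 * (((n : ℝ) - 1) * (m - 1)) := by nlinarith
    nlinarith
  have hw : |1 / (n : ℝ) - 1 / m| ≤ C / (n : ℝ) ^ 2 := by
    have hnm : 1 / (n : ℝ) - 1 / m = C / (n * m) := by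
      have : (n : ℝ) ≠ 0 := by linarith
      have : m ≠ 0 := by linarith
      field_simp
      rw [hm]
      ring
    rw [hnm, abs_of_nonneg (by positivity)]
    gcongr
    nlinarith
  have hb2 : |0 - (n : ℝ) / (n - 1)| ≤ 2 := by
    rw [zero_sub, abs_neg, abs_of_nonneg hbn.1]
    exact hbn.2
  have hm1 : |1 - 1 / m| ≤ 1 := by
    have : 1 / m ≤ 1 := by rw [div_le_one (by linarith)]; linarith
    have : 0 ≤ 1 / m := by positivity
    rw [abs_le]
    constructor <;> linarith
  set K := (1 / σ * Real.exp (1 / σ ^ 2)) * Real.exp (-(1 / (8 * σ ^ 2)) * x ^ 2) with hK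
  have hK0 : 0 ≤ K := by positivity
  set A := Real.exp (-(x - 0) ^ 2 / (2 * σ ^ 2))
  set B := Real.exp (-(x - (n : ℝ) / (n - 1)) ^ 2 / (2 * σ ^ 2))
  set B' := Real.exp (-(x - m / (m - 1)) ^ 2 / (2 * σ ^ 2))
  have key : |1 / (n : ℝ) * A + (1 - 1 / (n : ℝ)) * B - (1 / m * A + (1 - 1 / m) * B')| ≤
      K * (6 * C / (n : ℝ) ^ 2) :=
    calc _ = |(1 / (n : ℝ) - 1 / m) * (A - B) + (1 - 1 / m) * (B - B')| := by
          congr 1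
          ring
      _ ≤ |1 / (n : ℝ) - 1 / m| * |A - B| + |1 - 1 / m| * |B - B'| := by
          rw [← abs_mul, ← abs_mul]
          exact abs_add_le _ _
      _ ≤ C / (n : ℝ) ^ 2 * (K * 2) + 1 * (K * (4 * C / (n : ℝ) ^ 2)) := by
          have h1' := h1.trans (mul_le_mul_of_nonneg_left hb2 hK0)
          have h2' := h2.trans (mul_le_mul_of_nonneg_left hd' hK0)
          gcongr
      _ = K * (6 * C / (n : ℝ) ^ 2) := by ring
  calc _ ≤ 1 / Real.sqrt (2 * Real.pi * σ ^ 2) * (K * (6 * C / (n : ℝ) ^ 2)) := by gcongr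
    _ = _ := by rw [hK]; ring

/-- Fix `σ > 0` and an integer `C ≥ 1`. There is a constant `M > 0` (depending only on
`σ` and `C`) such that for all `n ≥ 2` the spectral distance between the complete graphs
`K_n` and `K_{n+C}` satisfies `D(K_n, K_{n+C}) ≤ M/n²`. -/
theorem spectral_distance_completeGraph_le (σ : ℝ) (hσ : 0 < σ) (C : ℕ) (hC : 1 ≤ C) :
    ∃ M : ℝ, 0 < M ∧ ∀ n : ℕ, 2 ≤ n →
      (∫ x : ℝ, |specDensity σ (⊤ : SimpleGraph (Fin n)) x
          - specDensity σ (⊤ : SimpleGraph (Fin (n + C))) x|)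
        ≤ M / (n : ℝ) ^ 2 := by
  set c := 1 / Real.sqrt (2 * Real.pi * σ ^ 2) * (1 / σ * Real.exp (1 / σ ^ 2))
  set I := ∫ x : ℝ, Real.exp (-(1 / (8 * σ ^ 2)) * x ^ 2)
  have hc0 : 0 ≤ c := by positivity
  have hI0 : 0 ≤ I := MeasureTheory.integral_nonneg fun x => (Real.exp_pos _).le
  refine ⟨c * (6 * C) * I + 1, by positivity, fun n hn => ?_⟩
  have hexp : MeasureTheory.Integrable fun x : ℝ => Real.exp (-(1 / (8 * σ ^ 2)) * x ^ 2) :=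
    integrable_exp_neg_mul_sq (by positivity)
  calc _ ≤ ∫ x : ℝ, (c * (6 * C / (n : ℝ) ^ 2)) * Real.exp (-(1 / (8 * σ ^ 2)) * x ^ 2) :=
        MeasureTheory.integral_mono_of_nonneg (Filter.Eventually.of_forall fun x => abs_nonneg _)
          (hexp.const_mul _)
          (Filter.Eventually.of_forall fun x => abs_specDensity_top_sub_le hσ C n hn x)
    _ = c * (6 * C) * I / (n : ℝ) ^ 2 := by
        rw [MeasureTheory.integral_const_mul]
        ring
    _ ≤ (c * (6 * C) * I + 1) / (n : ℝ) ^ 2 := by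
        gcongr
        linarith
end
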